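/- Let E be a real Banach space, T > 0, 0 < α₀ < 1, r ≥ 1, N ≥ 1, and consider the graded mesh t_n = T(n/N)^r with step sizes τ_n = t_n − t_{n−1}, the nonuniform L1 weights a^{(n)}_{n−k} with exponent α₀, and the complementary discrete convolution kernels P^{(n)}_{n−k}. Let u : [0,T] → E be continuous, twice continuously differentiable on (0,T], with ‖u'(t)‖ ≤ C_u t^{α₀−1} and ‖u''(t)‖ ≤ C_u t^{α₀−2} for all t ∈ (0,T]. Define the Caputo derivative ∂^{α₀}u(t_n) = ∫_0^{t_n} β_{1−α₀}(t_n − s) u'(s) ds (a Bochner integral), the L1 approximation D_N^{α₀} uⁿ = Σ_{k=1}^{n} a^{(n)}_{n−k} (u(t_k) − u(t_{k−1})), and the truncation error (R₁)ⁿ = D_N^{α₀} uⁿ − ∂^{α₀}u(t_n). Then there exists a constant C, depending only on r, α₀, T, C_u and not on N or m, such that Σ_{n=1}^{m} P^{(m)}_{m−n} ‖(R₁)ⁿ‖ ≤ C N^{−min{2−α₀, rα₀}} for every 1 ≤ m ≤ N. -/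

import Mathlib

open MeasureTheory intervalIntegral

/-- `β_ν(t) = t^(ν-1)/Γ(ν)`. -/
noncomputable def betaK (ν t : ℝ) : ℝ := t ^ (ν - 1) / Real.Gamma ν

/-- The graded temporal mesh `t_n = T (n/N)^r`. -/
noncomputable def gm (T r : ℝ) (N n : ℕ) : ℝ := T * ((n : ℝ) / (N : ℝ)) ^ r

/-- The nonuniform L1 weight `a^{(n)}_{n-k}` on the graded mesh. -/
noncomputable def L1w (T r α : ℝ) (N n k : ℕ) : ℝ :=
  (betaK (2 - α) (gm T r N n - gm T r N (k - 1)) - betaK (2 - α) (gm T r N n - gm T r N k)) /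
    (gm T r N k - gm T r N (k - 1))

section Kernel

variable {a : ℕ → ℕ → ℝ} {p : ℕ → ℝ} {m : ℕ}

/-- Complementary kernels of a monotone convolution matrix are nonnegative. -/
lemma complementary_nonneg (hpos : ∀ k, 1 ≤ k → k ≤ m → 0 < a k k)
    (hmono : ∀ j k, 1 ≤ k → k + 1 ≤ j → j ≤ m → a j k ≤ a j (k + 1))
    (hm : p m = 1 / a m m)
    (hp : ∀ k, 1 ≤ k → k + 1 ≤ m →
      p k = (1 / a k k) * ∑ j ∈ Finset.Icc (k + 1) m, (a j (k + 1) - a j k) * p j) :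
    ∀ k, 1 ≤ k → k ≤ m → 0 ≤ p k := by
  intro k hk hkm
  induction h : m - k using Nat.strong_induction_on generalizing k with
  | _ d ih =>
    rcases hkm.eq_or_lt with rfl | hlt
    · rw [hm]; exact one_div_nonneg.2 (hpos _ hk le_rfl).le
    · rw [hp k hk hlt]
      refine mul_nonneg (one_div_nonneg.2 (hpos _ hk hkm).le) (Finset.sum_nonneg fun j hj => ?_)
      rw [Finset.mem_Icc] at hj
      exact mul_nonneg (sub_nonneg.2 (hmono j k hk hj.1 hj.2))
        (ih (m - j) (by omega) j (by omega) hj.2 rfl)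

/-- The complementarity identity `∑_{j=k}^m p_j a_{j,k} = 1`. -/
lemma complementary_sum_eq_one (hpos : ∀ k, 1 ≤ k → k ≤ m → 0 < a k k)
    (hm : p m = 1 / a m m)
    (hp : ∀ k, 1 ≤ k → k + 1 ≤ m →
      p k = (1 / a k k) * ∑ j ∈ Finset.Icc (k + 1) m, (a j (k + 1) - a j k) * p j) :
    ∀ k, 1 ≤ k → k ≤ m → ∑ j ∈ Finset.Icc k m, p j * a j k = 1 := by
  intro k hk hkm
  induction h : m - k generalizing k with
  | zero =>
    obtain rfl : k = m := by omega
    have := (hpos k hk le_rfl).ne'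
    simp [hm, this]
  | succ d ih =>
    have := (hpos k hk hkm).ne'
    rw [← Finset.add_sum_Ioc_eq_sum_Icc hkm, ← Finset.Icc_add_one_left_eq_Ioc,
      ← ih (k + 1) (by omega) (by omega) (by omega), hp k hk (by omega)]
    have h2 : 1 / a k k * (∑ j ∈ Finset.Icc (k + 1) m, (a j (k + 1) - a j k) * p j) * a k k =
        ∑ j ∈ Finset.Icc (k + 1) m, (a j (k + 1) - a j k) * p j := by
      field_simp
    rw [h2, ← Finset.sum_add_distrib]
    exact Finset.sum_congr rfl fun j _ => by ring

/-- Stability: a consistency error dominated by weight differences is controlled after summation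
against the complementary kernels. -/
lemma complementary_sum_le (h1m : 1 ≤ m) (hpos : ∀ k, 1 ≤ k → k ≤ m → 0 < a k k)
    (hmono : ∀ j k, 1 ≤ k → k + 1 ≤ j → j ≤ m → a j k ≤ a j (k + 1))
    (hnn : ∀ j, 1 ≤ j → j ≤ m → 0 ≤ a j 1)
    (hm : p m = 1 / a m m)
    (hp : ∀ k, 1 ≤ k → k + 1 ≤ m →
      p k = (1 / a k k) * ∑ j ∈ Finset.Icc (k + 1) m, (a j (k + 1) - a j k) * p j)
    {R G : ℕ → ℝ} {A B K : ℝ} (hA : 0 ≤ A) (hB : 0 ≤ B) (hK : 0 ≤ K)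
    (hR1 : R 1 ≤ A)
    (hR : ∀ n, 2 ≤ n → n ≤ m →
      R n ≤ a n 2 * B + ∑ k ∈ Finset.Ico 1 n, (a n (k + 1) - a n k) * G k)
    (hG : ∀ k, 1 ≤ k → k + 1 ≤ m → a k k * G k ≤ K * a k 1) :
    ∑ n ∈ Finset.Icc 1 m, p n * R n ≤ A / a 1 1 + B + K := by
  have hp0 := complementary_nonneg hpos hmono hm hp
  have hsum := complementary_sum_eq_one hpos hm hp
  have ha1 := hpos 1 le_rfl h1m
  have hp1 : p 1 ≤ 1 / a 1 1 := by
    rw [le_div_iff₀ ha1, ← hsum 1 le_rfl h1m]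
    refine Finset.single_le_sum (f := fun j => p j * a j 1) (fun j hj => ?_)
      (Finset.mem_Icc.2 ⟨le_rfl, h1m⟩)
    rw [Finset.mem_Icc] at hj
    exact mul_nonneg (hp0 j hj.1 hj.2) (hnn j hj.1 hj.2)
  have hBsum : ∑ n ∈ Finset.Icc 2 m, p n * (a n 2 * B) ≤ B := by
    rcases h1m.eq_or_lt with rfl | h2
    · simpa using hB
    · simp_rw [← mul_assoc]
      rw [← Finset.sum_mul, hsum 2 (by norm_num) h2, one_mul]
  have hswap : ∑ n ∈ Finset.Icc 2 m, p n * ∑ k ∈ Finset.Ico 1 n, (a n (k + 1) - a n k) * G k =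
      ∑ k ∈ Finset.Ico 1 m, p k * (a k k * G k) := by
    have h1 : ∀ k ∈ Finset.Ico 1 m, p k * (a k k * G k) =
        ∑ n ∈ Finset.Icc (k + 1) m, p n * ((a n (k + 1) - a n k) * G k) := by
      intro k hk
      rw [Finset.mem_Ico] at hk
      have := (hpos k hk.1 hk.2.le).ne'
      rw [hp k hk.1 hk.2]
      have h2 : 1 / a k k * (∑ j ∈ Finset.Icc (k + 1) m, (a j (k + 1) - a j k) * p j)
          * (a k k * G k) = (∑ j ∈ Finset.Icc (k + 1) m, (a j (k + 1) - a j k) * p j) * G k := by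
        field_simp
      rw [h2, Finset.sum_mul]
      exact Finset.sum_congr rfl fun j _ => by ring
    rw [Finset.sum_congr rfl h1]
    simp_rw [Finset.mul_sum]
    refine Finset.sum_comm' fun n k => ?_
    simp only [Finset.mem_Icc, Finset.mem_Ico]
    omega
  have hKsum : ∑ k ∈ Finset.Ico 1 m, p k * (a k k * G k) ≤ K := by
    calc ∑ k ∈ Finset.Ico 1 m, p k * (a k k * G k)
        ≤ ∑ k ∈ Finset.Ico 1 m, K * (p k * a k 1) := by
          refine Finset.sum_le_sum fun k hk => ?_
          rw [Finset.mem_Ico] at hk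
          have := mul_le_mul_of_nonneg_left (hG k hk.1 hk.2) (hp0 k hk.1 hk.2.le)
          linarith
      _ ≤ ∑ k ∈ Finset.Icc 1 m, K * (p k * a k 1) := by
          refine Finset.sum_le_sum_of_subset_of_nonneg Finset.Ico_subset_Icc_self fun j hj _ => ?_
          rw [Finset.mem_Icc] at hj
          exact mul_nonneg hK (mul_nonneg (hp0 j hj.1 hj.2) (hnn j hj.1 hj.2))
      _ = K := by rw [← Finset.mul_sum, hsum 1 le_rfl h1m, mul_one]
  have hfirst : p 1 * R 1 ≤ A / a 1 1 := by
    calc p 1 * R 1 ≤ p 1 * A := mul_le_mul_of_nonneg_left hR1 (hp0 1 le_rfl h1m)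
      _ ≤ 1 / a 1 1 * A := mul_le_mul_of_nonneg_right hp1 hA
      _ = A / a 1 1 := by ring
  have hrest : ∑ n ∈ Finset.Icc 2 m, p n * R n ≤ B + K := by
    calc ∑ n ∈ Finset.Icc 2 m, p n * R n
        ≤ ∑ n ∈ Finset.Icc 2 m, (p n * (a n 2 * B) +
            p n * ∑ k ∈ Finset.Ico 1 n, (a n (k + 1) - a n k) * G k) := by
          refine Finset.sum_le_sum fun n hn => ?_
          rw [Finset.mem_Icc] at hn
          rw [← mul_add]
          exact mul_le_mul_of_nonneg_left (hR n hn.1 hn.2) (hp0 n (by omega) hn.2)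
      _ ≤ B + K := by
          rw [Finset.sum_add_distrib, hswap]
          exact add_le_add hBsum hKsum
  rw [← Finset.add_sum_Ioc_eq_sum_Icc h1m, ← Finset.Icc_add_one_left_eq_Ioc]
  norm_num
  linarith

end Kernel

/-- Lower bound for the increments of `x ↦ x ^ r` at integers. -/
lemma rpow_pred_le_rpow_sub {r x : ℝ} (hr : 1 ≤ r) (hx : 1 ≤ x) :
    x ^ (r - 1) ≤ x ^ r - (x - 1) ^ r := by
  have hx0 : 0 < x := by linarith
  have h1 : (x - 1) ^ r ≤ (x - 1) * x ^ (r - 1) := by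
    rcases hx.eq_or_lt with rfl | h
    · simp [Real.zero_rpow (by linarith : r ≠ 0)]
    · have : (x - 1) ^ r = (x - 1) * (x - 1) ^ (r - 1) := by
        rw [Real.rpow_sub_one (by linarith)]
        field_simp
      rw [this]
      gcongr
      linarith
  have h2 : x ^ r = x * x ^ (r - 1) := by
    rw [Real.rpow_sub_one hx0.ne']
    field_simp
  rw [h2]
  linarith

/-- Upper bound for the increments of `x ↦ x ^ r` at integers. -/
lemma rpow_succ_sub_le {r x : ℝ} (hr : 1 ≤ r) (hx : 1 ≤ x) :
    (x + 1) ^ r - x ^ r ≤ r * 2 ^ (r - 1) * x ^ (r - 1) := by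
  have hx0 : 0 < x + 1 := by linarith
  have h1 : 1 + r * (-1 / (x + 1)) ≤ (1 + -1 / (x + 1)) ^ r :=
    one_add_mul_self_le_rpow_one_add (by rw [le_div_iff₀ hx0]; linarith) hr
  have h2 : (1 + -1 / (x + 1)) = x / (x + 1) := by field_simp; ring
  rw [h2, Real.div_rpow (by linarith) hx0.le, le_div_iff₀ (by positivity)] at h1
  have h3 : (x + 1) ^ r = (x + 1) * (x + 1) ^ (r - 1) := by
    rw [Real.rpow_sub_one hx0.ne']
    field_simp
  have h4 : (x + 1) ^ (r - 1) ≤ 2 ^ (r - 1) * x ^ (r - 1) := by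
    rw [← Real.mul_rpow (by norm_num) (by linarith)]
    gcongr
    all_goals linarith
  have h5 : (1 + r * (-1 / (x + 1))) * (x + 1) ^ r = (x + 1) ^ r - r * (x + 1) ^ (r - 1) := by
    rw [h3]
    field_simp
    ring
  have h6 := mul_le_mul_of_nonneg_left h4 (by linarith : 0 ≤ r)
  linarith

lemma rpow_mul_rpow_le_rpow_neg_min {x y A B : ℝ} (hx : 1 ≤ x) (hxy : x ≤ y) :
    y ^ (-A) * x ^ (A - B) ≤ y ^ (-(min B A)) := by
  have hy : 0 < y := by linarith
  rcases le_total B A with h | h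
  · rw [min_eq_left h]
    calc y ^ (-A) * x ^ (A - B) ≤ y ^ (-A) * y ^ (A - B) := by
          gcongr
      _ = y ^ (-B) := by rw [← Real.rpow_add hy]; ring_nf
  · rw [min_eq_right h]
    calc y ^ (-A) * x ^ (A - B) ≤ y ^ (-A) * 1 := by
          gcongr
          exact Real.rpow_le_one_of_one_le_of_nonpos hx (by linarith)
      _ = y ^ (-A) := mul_one _

section Mesh

variable {T r : ℝ} {N : ℕ}

lemma gm_zero (T : ℝ) (N : ℕ) (hr : 1 ≤ r) : gm T r N 0 = 0 := by
  simp [gm, Real.zero_rpow (by linarith : r ≠ 0)]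

lemma gm_self (T r : ℝ) (hN : 1 ≤ N) : gm T r N N = T := by
  have : (N : ℝ) ≠ 0 := by positivity
  simp [gm, this]

lemma gm_strictMono (hT : 0 < T) (hr : 1 ≤ r) (hN : 1 ≤ N) : StrictMono (gm T r N) := by
  intro i j hij
  have : (0 : ℝ) < N := by positivity
  unfold gm
  gcongr

lemma gm_eq (T r : ℝ) (N n : ℕ) : gm T r N n = T * (N : ℝ) ^ (-r) * (n : ℝ) ^ r := by
  unfold gm
  rw [Real.div_rpow (by positivity) (by positivity), Real.rpow_neg (by positivity)]
  ring

lemma gm_one_rpow (hT : 0 < T) (r α : ℝ) (N : ℕ) :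
    gm T r N 1 ^ α = T ^ α * (N : ℝ) ^ (-(r * α)) := by
  rw [gm_eq, Nat.cast_one, Real.one_rpow, mul_one, Real.mul_rpow hT.le (by positivity),
    ← Real.rpow_mul (by positivity)]
  ring_nf

/-- The grading balances the step sizes against the singularity at the origin. -/
lemma gm_graded_bound {α : ℝ} (hT : 0 < T) (hr : 1 ≤ r) (hα : 0 < α) {k : ℕ}
    (hk : 1 ≤ k) (hkN : k + 1 ≤ N) :
    (gm T r N k - gm T r N (k - 1)) ^ (-α) *
        ((gm T r N (k + 1) - gm T r N k) ^ 2 * gm T r N k ^ (α - 2)) ≤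
      T ^ α * (r * 2 ^ (r - 1)) ^ 2 * (N : ℝ) ^ (-(min (2 - α) (r * α))) *
        gm T r N k ^ (-α) := by
  have hk1 : (1 : ℝ) ≤ k := by exact_mod_cast hk
  have hk0 : (0 : ℝ) < k := by linarith
  have hN0 : (0 : ℝ) < N := by
    have : 0 < N := by omega
    exact_mod_cast this
  obtain ⟨x, hx⟩ : ∃ x, x = T * (N : ℝ) ^ (-r) := ⟨_, rfl⟩
  have hx0 : 0 < x := by rw [hx]; positivity
  have hy0 : 0 < (k : ℝ) ^ (r - 1) := by positivity
  have e1 : x * (k : ℝ) ^ (r - 1) ≤ gm T r N k - gm T r N (k - 1) := by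
    rw [gm_eq, gm_eq, ← hx, ← mul_sub, Nat.cast_sub hk, Nat.cast_one]
    exact mul_le_mul_of_nonneg_left (rpow_pred_le_rpow_sub hr hk1) hx0.le
  have e2 : gm T r N (k + 1) - gm T r N k ≤ x * (r * 2 ^ (r - 1) * (k : ℝ) ^ (r - 1)) := by
    rw [gm_eq, gm_eq, ← hx, ← mul_sub, Nat.cast_add, Nat.cast_one]
    exact mul_le_mul_of_nonneg_left (rpow_succ_sub_le hr hk1) hx0.le
  have e20 : 0 ≤ gm T r N (k + 1) - gm T r N k :=
    sub_nonneg.2 (gm_strictMono hT hr (by omega) (Nat.lt_succ_self k)).le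
  have hgk : gm T r N k = x * (k : ℝ) ^ r := by rw [gm_eq, hx]
  have hgk0 : 0 < gm T r N k := by rw [hgk]; positivity
  have hxa : x ^ α = T ^ α * (N : ℝ) ^ (-(r * α)) := by
    rw [hx, Real.mul_rpow hT.le (by positivity), ← Real.rpow_mul hN0.le]
    ring_nf
  calc (gm T r N k - gm T r N (k - 1)) ^ (-α) *
        ((gm T r N (k + 1) - gm T r N k) ^ 2 * gm T r N k ^ (α - 2))
      ≤ (x * (k : ℝ) ^ (r - 1)) ^ (-α) *
        ((x * (r * 2 ^ (r - 1) * (k : ℝ) ^ (r - 1))) ^ 2 * gm T r N k ^ (α - 2)) := by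
        gcongr ?_ * (?_ ^ 2 * _)
        exact Real.rpow_le_rpow_of_nonpos (by positivity) e1 (by linarith)
    _ = (r * 2 ^ (r - 1)) ^ 2 * (x ^ α * (k : ℝ) ^ (r * α - (2 - α))) * gm T r N k ^ (-α) := by
        rw [hgk, Real.mul_rpow hx0.le hy0.le, Real.mul_rpow hx0.le (by positivity),
          Real.mul_rpow hx0.le (by positivity), ← Real.rpow_mul hk0.le, ← Real.rpow_mul hk0.le,
          ← Real.rpow_mul hk0.le, mul_pow x, mul_pow (r * 2 ^ (r - 1)), ← Real.rpow_mul_natCast hk0.le (r - 1) 2,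
          ← Real.rpow_natCast x 2]
        have h1 : x ^ (-α) * x ^ ((2 : ℕ) : ℝ) * x ^ (α - 2) = x ^ α * x ^ (-α) := by
          rw [← Real.rpow_add hx0, ← Real.rpow_add hx0, ← Real.rpow_add hx0]
          congr 1
          push_cast
          ring
        have h2 : (k : ℝ) ^ ((r - 1) * -α) * (k : ℝ) ^ ((r - 1) * (2 : ℕ)) *
            (k : ℝ) ^ (r * (α - 2)) = (k : ℝ) ^ (r * α - (2 - α)) * (k : ℝ) ^ (r * -α) := by
          rw [← Real.rpow_add hk0, ← Real.rpow_add hk0, ← Real.rpow_add hk0]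
          congr 1
          push_cast
          ring
        linear_combination (r * 2 ^ (r - 1)) ^ 2 * ((k : ℝ) ^ ((r - 1) * -α) *
          (k : ℝ) ^ ((r - 1) * (2 : ℕ)) * (k : ℝ) ^ (r * (α - 2))) * h1 +
          (r * 2 ^ (r - 1)) ^ 2 * (x ^ α * x ^ (-α)) * h2
    _ ≤ T ^ α * (r * 2 ^ (r - 1)) ^ 2 * (N : ℝ) ^ (-(min (2 - α) (r * α))) *
        gm T r N k ^ (-α) := by
        have h3 : (N : ℝ) ^ (-(r * α)) * (k : ℝ) ^ (r * α - (2 - α)) ≤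
            (N : ℝ) ^ (-(min (2 - α) (r * α))) :=
          rpow_mul_rpow_le_rpow_neg_min hk1 (by exact_mod_cast (by omega : k ≤ N))
        rw [hxa]
        calc _ = T ^ α * (r * 2 ^ (r - 1)) ^ 2 *
              ((N : ℝ) ^ (-(r * α)) * (k : ℝ) ^ (r * α - (2 - α))) * gm T r N k ^ (-α) := by ring
          _ ≤ _ := by gcongr

end Mesh

section BetaK

variable {α a b c : ℝ}

lemma betaK_one_sub (α t : ℝ) : betaK (1 - α) t = t ^ (-α) / Real.Gamma (1 - α) := by
  rw [betaK]
  ring_nf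

lemma Gamma_two_sub (h1 : α < 1) : Real.Gamma (2 - α) = (1 - α) * Real.Gamma (1 - α) := by
  rw [← Real.Gamma_add_one (by linarith)]
  ring_nf

lemma betaK_nonneg (h1 : α < 1) {t : ℝ} (ht : 0 ≤ t) : 0 ≤ betaK (1 - α) t := by
  have := Real.Gamma_pos_of_pos (by linarith : 0 < 1 - α)
  rw [betaK_one_sub]
  positivity

lemma betaK_anti (h0 : 0 < α) (h1 : α < 1) {s t : ℝ} (hs : 0 < s) (hst : s ≤ t) :
    betaK (1 - α) t ≤ betaK (1 - α) s := by
  have := Real.Gamma_pos_of_pos (by linarith : 0 < 1 - α)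
  rw [betaK_one_sub, betaK_one_sub]
  exact div_le_div_of_nonneg_right (Real.rpow_le_rpow_of_nonpos hs hst (by linarith)) this.le

lemma intervalIntegrable_betaK (h1 : α < 1) (a b c : ℝ) :
    IntervalIntegrable (fun s => betaK (1 - α) (c - s)) volume a b := by
  simp_rw [betaK_one_sub]
  have h : IntervalIntegrable (fun s : ℝ => s ^ (-α)) volume (c - a) (c - b) :=
    intervalIntegrable_rpow' (by linarith)
  simpa using (h.comp_sub_left c).div_const _

lemma integral_betaK (h1 : α < 1) (a b c : ℝ) :
    ∫ s in a..b, betaK (1 - α) (c - s) = betaK (2 - α) (c - a) - betaK (2 - α) (c - b) := by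
  have hG := Real.Gamma_pos_of_pos (by linarith : 0 < 1 - α)
  have h1' : 1 - α ≠ 0 := by linarith
  rw [intervalIntegral.integral_comp_sub_left (fun s => betaK (1 - α) s)]
  simp_rw [betaK_one_sub]
  rw [intervalIntegral.integral_div, integral_rpow (Or.inl (by linarith)), betaK, betaK,
    Gamma_two_sub h1, show -α + 1 = 1 - α by ring, show 2 - α - 1 = 1 - α by ring]
  field_simp

lemma mul_betaK_le_integral (h0 : 0 < α) (h1 : α < 1) (hab : a ≤ b) (hbc : b ≤ c) :
    (b - a) * betaK (1 - α) (c - a) ≤ ∫ s in a..b, betaK (1 - α) (c - s) := by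
  have := intervalIntegral.integral_mono_on_of_le_Ioo (μ := volume) hab
    (f := fun _ => betaK (1 - α) (c - a)) (g := fun s => betaK (1 - α) (c - s))
    (by simp) (intervalIntegrable_betaK h1 a b c)
    (fun s hs => betaK_anti h0 h1 (by linarith [hs.2]) (by linarith [hs.1]))
  simpa using this

lemma integral_le_mul_betaK (h0 : 0 < α) (h1 : α < 1) (hab : a ≤ b) (hbc : b < c) :
    ∫ s in a..b, betaK (1 - α) (c - s) ≤ (b - a) * betaK (1 - α) (c - b) := by
  have := intervalIntegral.integral_mono_on_of_le_Ioo (μ := volume) hab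
    (f := fun s => betaK (1 - α) (c - s)) (g := fun _ => betaK (1 - α) (c - b))
    (intervalIntegrable_betaK h1 a b c) (by simp)
    (fun s hs => betaK_anti h0 h1 (by linarith [hs.2]) (by linarith [hs.2]))
  simpa using this

/-- Pointwise splitting of the doubly singular integrand. -/
lemma rpow_mul_rpow_le_split {c s : ℝ} (h0 : 0 < α) (h1 : α < 1) (hs : 0 < s) (hsc : s ≤ c) :
    (c - s) ^ (-α) * s ^ (α - 1) ≤
      (c / 2) ^ (-α) * s ^ (α - 1) + (c / 2) ^ (α - 1) * (c - s) ^ (-α) := by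
  have hc : 0 < c := by linarith
  have hcs : 0 ≤ c - s := by linarith
  rcases le_total s (c / 2) with h | h
  · have : (c - s) ^ (-α) ≤ (c / 2) ^ (-α) :=
      Real.rpow_le_rpow_of_nonpos (by linarith) (by linarith) (by linarith)
    have h2 : (c - s) ^ (-α) * s ^ (α - 1) ≤ (c / 2) ^ (-α) * s ^ (α - 1) := by gcongr
    have h3 : 0 ≤ (c / 2) ^ (α - 1) * (c - s) ^ (-α) := by positivity
    linarith
  · have : s ^ (α - 1) ≤ (c / 2) ^ (α - 1) :=
      Real.rpow_le_rpow_of_nonpos (by linarith) h (by linarith)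
    have h2 : (c - s) ^ (-α) * s ^ (α - 1) ≤ (c - s) ^ (-α) * (c / 2) ^ (α - 1) := by gcongr
    have h3 : 0 ≤ (c / 2) ^ (-α) * s ^ (α - 1) := by positivity
    linarith

lemma intervalIntegrable_split (h0 : 0 < α) (h1 : α < 1) (c : ℝ) :
    IntervalIntegrable (fun s => (c / 2) ^ (-α) * s ^ (α - 1) +
      (c / 2) ^ (α - 1) * (c - s) ^ (-α)) volume 0 c := by
  have h2 : IntervalIntegrable (fun s : ℝ => (c - s) ^ (-α)) volume 0 c := by
    have h : IntervalIntegrable (fun s : ℝ => s ^ (-α)) volume (c - 0) (c - c) :=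
      intervalIntegrable_rpow' (by linarith)
    simpa using h.comp_sub_left c
  exact ((intervalIntegrable_rpow' (by linarith)).const_mul _).add (h2.const_mul _)

lemma integral_split_le (h0 : 0 < α) (h1 : α < 1) (hc : 0 < c) :
    ∫ s in (0 : ℝ)..c, ((c / 2) ^ (-α) * s ^ (α - 1) + (c / 2) ^ (α - 1) * (c - s) ^ (-α)) ≤
      2 / α + 2 / (1 - α) := by
  have h1' : 0 < 1 - α := by linarith
  have h2 : IntervalIntegrable (fun s : ℝ => (c - s) ^ (-α)) volume 0 c := by
    have h : IntervalIntegrable (fun s : ℝ => s ^ (-α)) volume (c - 0) (c - c) :=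
      intervalIntegrable_rpow' (by linarith)
    simpa using h.comp_sub_left c
  rw [intervalIntegral.integral_add ((intervalIntegrable_rpow' (by linarith)).const_mul _)
    (h2.const_mul _), intervalIntegral.integral_const_mul, intervalIntegral.integral_const_mul,
    intervalIntegral.integral_comp_sub_left (fun s => s ^ (-α)),
    integral_rpow (Or.inl (by linarith)), integral_rpow (Or.inl (by linarith))]
  have e1 : α - 1 + 1 = α := by ring
  have e2 : -α + 1 = 1 - α := by ring
  rw [e1, e2, sub_self, sub_zero, Real.zero_rpow h0.ne', Real.zero_rpow h1'.ne', sub_zero, sub_zero]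
  have e3 : (c / 2) ^ (-α) * (c ^ α / α) = 2 ^ α / α := by
    rw [Real.div_rpow hc.le (by norm_num), Real.rpow_neg hc.le, Real.rpow_neg (by norm_num)]
    have := Real.rpow_pos_of_pos hc α
    have := Real.rpow_pos_of_pos (by norm_num : (0 : ℝ) < 2) α
    field_simp
  have e4 : (c / 2) ^ (α - 1) * (c ^ (1 - α) / (1 - α)) = 2 ^ (1 - α) / (1 - α) := by
    rw [show α - 1 = -(1 - α) by ring, Real.div_rpow hc.le (by norm_num), Real.rpow_neg hc.le,
      Real.rpow_neg (by norm_num)]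
    have := Real.rpow_pos_of_pos hc (1 - α)
    have := Real.rpow_pos_of_pos (by norm_num : (0 : ℝ) < 2) (1 - α)
    field_simp
  have e5 : (2 : ℝ) ^ α ≤ 2 := by
    simpa using Real.rpow_le_rpow_of_exponent_le (by norm_num : (1 : ℝ) ≤ 2) h1.le
  have e6 : (2 : ℝ) ^ (1 - α) ≤ 2 := by
    simpa using Real.rpow_le_rpow_of_exponent_le (by norm_num : (1 : ℝ) ≤ 2)
      (by linarith : 1 - α ≤ 1)
  rw [e3, e4]
  gcongr

end BetaK

section Weights

variable {T r α : ℝ} {N : ℕ}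

lemma L1w_mul (h1 : α < 1) (hT : 0 < T) (hr : 1 ≤ r) (hN : 1 ≤ N) {k : ℕ} (n : ℕ) (hk : 1 ≤ k) :
    L1w T r α N n k * (gm T r N k - gm T r N (k - 1)) =
      ∫ s in gm T r N (k - 1)..gm T r N k, betaK (1 - α) (gm T r N n - s) := by
  have := sub_pos.2 (gm_strictMono hT hr hN (Nat.sub_lt hk one_pos))
  rw [integral_betaK h1, L1w, div_mul_cancel₀ _ this.ne']

lemma betaK_le_L1w (h0 : 0 < α) (h1 : α < 1) (hT : 0 < T) (hr : 1 ≤ r) (hN : 1 ≤ N) {n k : ℕ}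
    (hk : 1 ≤ k) (hkn : k ≤ n) :
    betaK (1 - α) (gm T r N n - gm T r N (k - 1)) ≤ L1w T r α N n k := by
  have hm := gm_strictMono hT hr hN
  have h := sub_pos.2 (hm (Nat.sub_lt hk one_pos))
  refine le_of_mul_le_mul_right ?_ h
  rw [L1w_mul h1 hT hr hN n hk, mul_comm]
  exact mul_betaK_le_integral h0 h1 (by linarith) (hm.monotone hkn)

lemma L1w_le_betaK (h0 : 0 < α) (h1 : α < 1) (hT : 0 < T) (hr : 1 ≤ r) (hN : 1 ≤ N) {n k : ℕ}
    (hk : 1 ≤ k) (hkn : k < n) :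
    L1w T r α N n k ≤ betaK (1 - α) (gm T r N n - gm T r N k) := by
  have hm := gm_strictMono hT hr hN
  have h := sub_pos.2 (hm (Nat.sub_lt hk one_pos))
  refine le_of_mul_le_mul_right ?_ h
  rw [L1w_mul h1 hT hr hN n hk, mul_comm (betaK _ _)]
  exact integral_le_mul_betaK h0 h1 (by linarith) (hm hkn)

lemma L1w_nonneg (h0 : 0 < α) (h1 : α < 1) (hT : 0 < T) (hr : 1 ≤ r) (hN : 1 ≤ N) {n k : ℕ}
    (hk : 1 ≤ k) (hkn : k ≤ n) : 0 ≤ L1w T r α N n k :=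
  (betaK_nonneg h1 (sub_nonneg.2 ((gm_strictMono hT hr hN).monotone (by omega)))).trans
    (betaK_le_L1w h0 h1 hT hr hN hk hkn)

lemma L1w_le_succ (h0 : 0 < α) (h1 : α < 1) (hT : 0 < T) (hr : 1 ≤ r) (hN : 1 ≤ N) {n k : ℕ}
    (hk : 1 ≤ k) (hkn : k + 1 ≤ n) : L1w T r α N n k ≤ L1w T r α N n (k + 1) := by
  have h := betaK_le_L1w h0 h1 hT hr hN (Nat.le_add_left 1 k) hkn
  rw [Nat.add_sub_cancel] at h
  exact (L1w_le_betaK h0 h1 hT hr hN hk hkn).trans h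

lemma L1w_self (h1 : α < 1) (hT : 0 < T) (hr : 1 ≤ r) (hN : 1 ≤ N) {k : ℕ} (hk : 1 ≤ k) :
    L1w T r α N k k = (gm T r N k - gm T r N (k - 1)) ^ (-α) / Real.Gamma (2 - α) := by
  have h := sub_pos.2 (gm_strictMono hT hr hN (Nat.sub_lt hk one_pos))
  rw [L1w, betaK, betaK, sub_self, Real.zero_rpow (by linarith), zero_div, sub_zero,
    show 2 - α - 1 = -α + 1 by ring, Real.rpow_add_one h.ne']
  field_simp

lemma L1w_self_pos (h1 : α < 1) (hT : 0 < T) (hr : 1 ≤ r) (hN : 1 ≤ N) {k : ℕ} (hk : 1 ≤ k) :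
    0 < L1w T r α N k k := by
  have h := sub_pos.2 (gm_strictMono hT hr hN (Nat.sub_lt hk one_pos))
  have := Real.Gamma_pos_of_pos (by linarith : 0 < 2 - α)
  rw [L1w_self h1 hT hr hN hk]
  positivity

end Weights

section Regularity

variable {E : Type*} [NormedAddCommGroup E] [NormedSpace ℝ E]

/-- The error of replacing a density by its mean, against a kernel bounded below. -/
lemma norm_integral_smul_sub_le [CompleteSpace E] {g : ℝ → ℝ} {w : ℝ → E} {d : E}
    {a b g₀ M : ℝ} (hab : a ≤ b) (hg : IntervalIntegrable g volume a b)
    (hw : IntervalIntegrable w volume a b)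
    (hgw : IntervalIntegrable (fun s => g s • w s) volume a b)
    (hg₀ : ∀ s ∈ Set.Ioo a b, g₀ ≤ g s) (hM : ∀ s ∈ Set.Ioo a b, ‖d - w s‖ ≤ M)
    (hd : ∫ s in a..b, w s = (b - a) • d) :
    ‖(∫ s in a..b, g s) • d - ∫ s in a..b, g s • w s‖ ≤
      M * ((∫ s in a..b, g s) - (b - a) * g₀) := by
  have hgd : IntervalIntegrable (fun s => g s • d) volume a b :=
    ⟨hg.1.smul_const d, hg.2.smul_const d⟩
  have hcd : IntervalIntegrable (fun _ : ℝ => g₀ • d) volume a b := by simp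
  have hcw : IntervalIntegrable (fun s => g₀ • w s) volume a b := hw.smul g₀
  have key : (∫ s in a..b, g s) • d - ∫ s in a..b, g s • w s =
      ∫ s in a..b, (g s - g₀) • (d - w s) := by
    have h : ∀ s, (g s - g₀) • (d - w s) = (g s • d - g s • w s) - (g₀ • d - g₀ • w s) := by
      intro s
      rw [sub_smul, smul_sub, smul_sub]
    simp_rw [h]
    rw [intervalIntegral.integral_sub (hgd.sub hgw) (hcd.sub hcw),
      intervalIntegral.integral_sub hgd hgw, intervalIntegral.integral_sub hcd hcw,
      intervalIntegral.integral_smul_const, intervalIntegral.integral_smul g₀ w, hd,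
      intervalIntegral.integral_const, smul_comm, sub_self, sub_zero]
  rw [key]
  have hint : IntervalIntegrable (fun s => M * (g s - g₀)) volume a b :=
    (hg.sub (by simp)).const_mul M
  have hb : ∀ᵐ s, s ∈ Set.Ioc a b → ‖(g s - g₀) • (d - w s)‖ ≤ M * (g s - g₀) := by
    filter_upwards [compl_mem_ae_iff.2 (measure_singleton (μ := volume) b)] with s hsb hs
    have hs' : s ∈ Set.Ioo a b := ⟨hs.1, lt_of_le_of_ne hs.2 hsb⟩
    have := sub_nonneg.2 (hg₀ s hs')
    rw [norm_smul, Real.norm_of_nonneg this, mul_comm]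
    exact mul_le_mul_of_nonneg_right (hM s hs') this
  refine (intervalIntegral.norm_integral_le_of_norm_le hab hb hint).trans_eq ?_
  rw [intervalIntegral.integral_const_mul, intervalIntegral.integral_sub hg (by simp),
    intervalIntegral.integral_const, smul_eq_mul]

/-- A function on `[0, T]` with a weak singularity of strength `α` at the origin. -/
structure WeaklySingular (α T Cu : ℝ) (u u' u'' : ℝ → E) : Prop where
  cont : ContinuousOn u (Set.Icc 0 T)
  deriv₁ : ∀ s ∈ Set.Ioc (0 : ℝ) T, HasDerivAt u (u' s) s
  deriv₂ : ∀ s ∈ Set.Ioc (0 : ℝ) T, HasDerivAt u' (u'' s) s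
  bound₁ : ∀ s ∈ Set.Ioc (0 : ℝ) T, ‖u' s‖ ≤ Cu * s ^ (α - 1)
  bound₂ : ∀ s ∈ Set.Ioc (0 : ℝ) T, ‖u'' s‖ ≤ Cu * s ^ (α - 2)

namespace WeaklySingular

variable {α T Cu a b c : ℝ} {u u' u'' : ℝ → E}

lemma const_nonneg (h : WeaklySingular α T Cu u u' u'') (hT : 0 < T) : 0 ≤ Cu := by
  have := (norm_nonneg _).trans (h.bound₁ T ⟨hT, le_rfl⟩)
  exact nonneg_of_mul_nonneg_left this (by positivity)

lemma aestronglyMeasurable (h : WeaklySingular α T Cu u u' u'') (ha : 0 ≤ a) (hab : a ≤ b)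
    (hb : b ≤ T) : AEStronglyMeasurable u' (volume.restrict (Set.uIoc a b)) := by
  rw [Set.uIoc_of_le hab]
  exact ContinuousOn.aestronglyMeasurable (fun s hs => (h.deriv₂ s
    ⟨ha.trans_lt hs.1, hs.2.trans hb⟩).continuousAt.continuousWithinAt) measurableSet_Ioc

lemma intervalIntegrable (h : WeaklySingular α T Cu u u' u'') (h0 : 0 < α) (ha : 0 ≤ a)
    (hab : a ≤ b) (hb : b ≤ T) : IntervalIntegrable u' volume a b := by
  refine IntervalIntegrable.mono_fun' (g := fun s => Cu * s ^ (α - 1))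
    ((intervalIntegrable_rpow' (by linarith)).const_mul _) (h.aestronglyMeasurable ha hab hb) ?_
  rw [Set.uIoc_of_le hab]
  exact (ae_restrict_mem measurableSet_Ioc).mono fun s hs =>
    h.bound₁ s ⟨ha.trans_lt hs.1, hs.2.trans hb⟩

lemma norm_betaK_smul_le (h : WeaklySingular α T Cu u u' u'') (h0 : 0 < α) (h1 : α < 1)
    (hT : 0 < T) {s : ℝ} (hs : 0 < s) (hsc : s ≤ c) (hc : c ≤ T) :
    ‖betaK (1 - α) (c - s) • u' s‖ ≤ Cu / Real.Gamma (1 - α) *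
      ((c / 2) ^ (-α) * s ^ (α - 1) + (c / 2) ^ (α - 1) * (c - s) ^ (-α)) := by
  have hG := Real.Gamma_pos_of_pos (by linarith : 0 < 1 - α)
  have hCu := h.const_nonneg hT
  have hcs : 0 ≤ c - s := by linarith
  rw [norm_smul, Real.norm_of_nonneg (betaK_nonneg h1 hcs), betaK_one_sub]
  calc (c - s) ^ (-α) / Real.Gamma (1 - α) * ‖u' s‖
      ≤ (c - s) ^ (-α) / Real.Gamma (1 - α) * (Cu * s ^ (α - 1)) := by
        gcongr
        exact h.bound₁ s ⟨hs, hsc.trans hc⟩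
    _ = Cu / Real.Gamma (1 - α) * ((c - s) ^ (-α) * s ^ (α - 1)) := by ring
    _ ≤ _ := by
        gcongr
        exact rpow_mul_rpow_le_split h0 h1 hs hsc

lemma intervalIntegrable_betaK_smul (h : WeaklySingular α T Cu u u' u'') (h0 : 0 < α)
    (h1 : α < 1) (hT : 0 < T) (hc0 : 0 ≤ c) (hc : c ≤ T) :
    IntervalIntegrable (fun s => betaK (1 - α) (c - s) • u' s) volume 0 c := by
  refine IntervalIntegrable.mono_fun' ((intervalIntegrable_split h0 h1 c).const_mul
    (Cu / Real.Gamma (1 - α)))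
    ((intervalIntegrable_betaK h1 0 c c).def'.aestronglyMeasurable.smul
      (h.aestronglyMeasurable le_rfl hc0 hc)) ?_
  rw [Set.uIoc_of_le hc0]
  exact (ae_restrict_mem measurableSet_Ioc).mono fun s hs =>
    h.norm_betaK_smul_le h0 h1 hT hs.1 hs.2 hc

lemma norm_integral_betaK_smul_le (h : WeaklySingular α T Cu u u' u'') (h0 : 0 < α)
    (h1 : α < 1) (hT : 0 < T) (hc0 : 0 < c) (hc : c ≤ T) :
    ‖∫ s in (0 : ℝ)..c, betaK (1 - α) (c - s) • u' s‖ ≤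
      Cu / Real.Gamma (1 - α) * (2 / α + 2 / (1 - α)) := by
  have hG := Real.Gamma_pos_of_pos (by linarith : 0 < 1 - α)
  have hCu := h.const_nonneg hT
  refine (intervalIntegral.norm_integral_le_of_norm_le hc0.le (Filter.Eventually.of_forall
    fun s hs => h.norm_betaK_smul_le h0 h1 hT hs.1 hs.2 hc)
    ((intervalIntegrable_split h0 h1 c).const_mul _)).trans ?_
  rw [intervalIntegral.integral_const_mul]
  gcongr
  exact integral_split_le h0 h1 hc0

/-- On an initial interval away from the kernel singularity. -/
lemma norm_integral_betaK_smul_le_of_lt (h : WeaklySingular α T Cu u u' u'') (h0 : 0 < α)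
    (h1 : α < 1) (hT : 0 < T) (hb0 : 0 ≤ b) (hbc : b < c) (hb : b ≤ T) :
    ‖∫ s in (0 : ℝ)..b, betaK (1 - α) (c - s) • u' s‖ ≤
      betaK (1 - α) (c - b) * (Cu * (b ^ α / α)) := by
  have hCu := h.const_nonneg hT
  have hbd : ∀ s ∈ Set.Ioc 0 b, ‖betaK (1 - α) (c - s) • u' s‖ ≤
      betaK (1 - α) (c - b) * (Cu * s ^ (α - 1)) := by
    intro s hs
    rw [norm_smul, Real.norm_of_nonneg (betaK_nonneg h1 (by linarith [hs.2]))]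
    have h3 := betaK_nonneg h1 (by linarith : 0 ≤ c - b)
    gcongr
    · exact betaK_anti h0 h1 (by linarith) (by linarith [hs.2])
    · exact h.bound₁ s ⟨hs.1, hs.2.trans hb⟩
  refine (intervalIntegral.norm_integral_le_of_norm_le hb0 (Filter.Eventually.of_forall hbd)
    (((intervalIntegrable_rpow' (by linarith)).const_mul _).const_mul _)).trans_eq ?_
  rw [intervalIntegral.integral_const_mul, intervalIntegral.integral_const_mul,
    integral_rpow (Or.inl (by linarith))]
  simp [Real.zero_rpow h0.ne']

lemma norm_mean_sub_le (h : WeaklySingular α T Cu u u' u'') (h0 : 0 < α) (h1 : α < 1)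
    (hT : 0 < T) (ha : 0 < a) (hab : a < b) (hb : b ≤ T) {s : ℝ} (hs : s ∈ Set.Icc a b) :
    ‖(b - a)⁻¹ • (u b - u a) - u' s‖ ≤ Cu * a ^ (α - 2) * (b - a) := by
  have hCu := h.const_nonneg hT
  have hτ : 0 < b - a := by linarith
  have hder : ∀ x ∈ Set.Icc a b, ‖u' x - u' s‖ ≤ Cu * a ^ (α - 2) * (b - a) := by
    intro x hx
    have h2 := Convex.norm_image_sub_le_of_norm_hasDerivWithin_le (f := u') (f' := u'')
      (C := Cu * a ^ (α - 2)) (s := Set.Icc a b)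
      (fun y hy => (h.deriv₂ y ⟨ha.trans_le hy.1, hy.2.trans hb⟩).hasDerivWithinAt)
      (fun y hy => (h.bound₂ y ⟨ha.trans_le hy.1, hy.2.trans hb⟩).trans
        (mul_le_mul_of_nonneg_left
          (Real.rpow_le_rpow_of_nonpos ha hy.1 (by linarith)) hCu))
      (convex_Icc a b) hs hx
    refine h2.trans ?_
    gcongr
    rw [Real.norm_eq_abs, abs_le]
    constructor <;> linarith [hx.1, hx.2, hs.1, hs.2]
  have hv := Convex.norm_image_sub_le_of_norm_hasDerivWithin_le (f := fun x => u x - x • u' s)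
      (f' := fun x => u' x - u' s) (C := Cu * a ^ (α - 2) * (b - a)) (s := Set.Icc a b)
      (fun x hx => by
        have h3 := (h.deriv₁ x ⟨ha.trans_le hx.1, hx.2.trans hb⟩).sub
          ((hasDerivAt_id x).smul_const (u' s))
        rw [one_smul] at h3
        exact h3.hasDerivWithinAt)
      hder (convex_Icc a b) (Set.left_mem_Icc.2 hab.le) (Set.right_mem_Icc.2 hab.le)
  have e : (b - a)⁻¹ • (u b - u a) - u' s =
      (b - a)⁻¹ • ((u b - b • u' s) - (u a - a • u' s)) := by
    have : (u b - b • u' s) - (u a - a • u' s) = (u b - u a) - (b - a) • u' s := by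
      rw [sub_smul]; abel
    rw [this, smul_sub _ (u b - u a), smul_smul, inv_mul_cancel₀ hτ.ne', one_smul]
  rw [e, norm_smul, norm_inv, Real.norm_of_nonneg hτ.le, inv_mul_le_iff₀ hτ]
  rw [Real.norm_of_nonneg hτ.le] at hv
  linarith

variable [CompleteSpace E]

lemma integral_eq_sub (h : WeaklySingular α T Cu u u' u'') (h0 : 0 < α) (ha : 0 ≤ a)
    (hab : a ≤ b) (hb : b ≤ T) : ∫ s in a..b, u' s = u b - u a :=
  intervalIntegral.integral_eq_sub_of_hasDerivAt_of_le hab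
    (h.cont.mono (Set.Icc_subset_Icc ha hb))
    (fun s hs => h.deriv₁ s ⟨ha.trans_lt hs.1, hs.2.le.trans hb⟩)
    (h.intervalIntegrable h0 ha hab hb)

lemma norm_sub_zero_le (h : WeaklySingular α T Cu u u' u'') (h0 : 0 < α) (hb0 : 0 ≤ b)
    (hb : b ≤ T) : ‖u b - u 0‖ ≤ Cu * (b ^ α / α) := by
  rw [← h.integral_eq_sub h0 le_rfl hb0 hb]
  refine (intervalIntegral.norm_integral_le_of_norm_le hb0 (Filter.Eventually.of_forall
    fun s hs => h.bound₁ s ⟨hs.1, hs.2.trans hb⟩)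
    ((intervalIntegrable_rpow' (by linarith)).const_mul _)).trans_eq ?_
  rw [intervalIntegral.integral_const_mul, integral_rpow (Or.inl (by linarith))]
  simp [Real.zero_rpow h0.ne']

/-- Local consistency error away from the origin. -/
lemma norm_local_error_le (h : WeaklySingular α T Cu u u' u'') (h0 : 0 < α) (h1 : α < 1)
    (hT : 0 < T) (ha : 0 < a) (hab : a < b) (hbc : b ≤ c) (hc : c ≤ T) :
    ‖((∫ s in a..b, betaK (1 - α) (c - s)) / (b - a)) • (u b - u a) -
        ∫ s in a..b, betaK (1 - α) (c - s) • u' s‖ ≤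
      Cu * a ^ (α - 2) * (b - a) *
        ((∫ s in a..b, betaK (1 - α) (c - s)) - (b - a) * betaK (1 - α) (c - a)) := by
  have hτ : 0 < b - a := by linarith
  rw [div_eq_mul_inv, mul_smul]
  refine norm_integral_smul_sub_le hab.le (intervalIntegrable_betaK h1 a b c)
    (h.intervalIntegrable h0 ha.le hab.le (hbc.trans hc))
    ((h.intervalIntegrable_betaK_smul h0 h1 hT (by linarith) hc).mono_set ?_)
    (fun s hs => betaK_anti h0 h1 (by linarith [hs.2]) (by linarith [hs.1]))
    (fun s hs => h.norm_mean_sub_le h0 h1 hT ha hab (hbc.trans hc) (Set.Ioo_subset_Icc_self hs)) ?_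
  · rw [Set.uIcc_of_le hab.le, Set.uIcc_of_le (by linarith)]
    exact Set.Icc_subset_Icc ha.le hbc
  · rw [h.integral_eq_sub h0 ha.le hab.le (hbc.trans hc), smul_smul, mul_inv_cancel₀ hτ.ne',
      one_smul]

end WeaklySingular

end Regularity

section Truncation

variable {E : Type*} [NormedAddCommGroup E] [NormedSpace ℝ E]
  {T r α Cu : ℝ} {N n : ℕ} {u u' u'' : ℝ → E}

lemma gm_le (hT : 0 < T) (hr : 1 ≤ r) (hN : 1 ≤ N) (hn : n ≤ N) : gm T r N n ≤ T := by
  simpa [gm_self T r hN] using (gm_strictMono hT hr hN).monotone hn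

lemma gm_nonneg (hT : 0 < T) (r : ℝ) (N n : ℕ) : 0 ≤ gm T r N n := by
  unfold gm
  positivity

/-- The truncation error is the sum of its local contributions. -/
lemma truncation_eq_sum_local (h : WeaklySingular α T Cu u u' u'') (h0 : 0 < α) (h1 : α < 1)
    (hT : 0 < T) (hr : 1 ≤ r) (hN : 1 ≤ N) (hn : n ≤ N) :
    (∑ k ∈ Finset.Icc 1 n, L1w T r α N n k • (u (gm T r N k) - u (gm T r N (k - 1)))) -
        ∫ s in (0 : ℝ)..gm T r N n, betaK (1 - α) (gm T r N n - s) • u' s =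
      ∑ k ∈ Finset.range n, (L1w T r α N n (k + 1) • (u (gm T r N (k + 1)) - u (gm T r N k)) -
        ∫ s in gm T r N k..gm T r N (k + 1), betaK (1 - α) (gm T r N n - s) • u' s) := by
  have hm := (gm_strictMono hT hr hN).monotone
  have hint := h.intervalIntegrable_betaK_smul h0 h1 hT (gm_nonneg hT r N n) (gm_le hT hr hN hn)
  have hadj := intervalIntegral.sum_integral_adjacent_intervals (μ := volume)
    (f := fun s => betaK (1 - α) (gm T r N n - s) • u' s) (a := gm T r N) (n := n)
    (fun k hk => hint.mono_set (by
      rw [Set.uIcc_of_le (hm (Nat.le_succ k)), Set.uIcc_of_le (gm_nonneg hT r N n)]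
      exact Set.Icc_subset_Icc (gm_nonneg hT r N k) (hm hk)))
  rw [gm_zero T N hr] at hadj
  have hsum : ∑ k ∈ Finset.Icc 1 n, L1w T r α N n k • (u (gm T r N k) - u (gm T r N (k - 1))) =
      ∑ k ∈ Finset.range n,
        L1w T r α N n (k + 1) • (u (gm T r N (k + 1)) - u (gm T r N k)) := by
    rw [← Finset.Ico_add_one_right_eq_Icc, Finset.sum_Ico_eq_sum_range, Nat.add_sub_cancel]
    exact Finset.sum_congr rfl fun k _ => by rw [add_comm 1 k, Nat.add_sub_cancel]
  rw [Finset.sum_sub_distrib, hadj, hsum]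

variable [CompleteSpace E]

lemma norm_truncation_one_le (h : WeaklySingular α T Cu u u' u'') (h0 : 0 < α) (h1 : α < 1)
    (hT : 0 < T) (hr : 1 ≤ r) (hN : 1 ≤ N) :
    ‖(∑ k ∈ Finset.Icc 1 1, L1w T r α N 1 k • (u (gm T r N k) - u (gm T r N (k - 1)))) -
        ∫ s in (0 : ℝ)..gm T r N 1, betaK (1 - α) (gm T r N 1 - s) • u' s‖ ≤
      L1w T r α N 1 1 * (Cu * (gm T r N 1 ^ α / α)) +
        Cu / Real.Gamma (1 - α) * (2 / α + 2 / (1 - α)) := by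
  have hpos : 0 < gm T r N 1 := by
    simpa [gm_zero T N hr] using gm_strictMono hT hr hN Nat.one_pos
  have hle := gm_le hT hr hN hN
  refine (norm_sub_le _ _).trans (add_le_add ?_
    (h.norm_integral_betaK_smul_le h0 h1 hT hpos hle))
  have ha := L1w_self_pos h1 hT hr hN le_rfl
  rw [Finset.Icc_self, Finset.sum_singleton, Nat.sub_self, gm_zero T N hr, norm_smul,
    Real.norm_of_nonneg ha.le]
  exact mul_le_mul_of_nonneg_left (h.norm_sub_zero_le h0 hpos.le hle) ha.le

lemma norm_truncation_le (h : WeaklySingular α T Cu u u' u'') (h0 : 0 < α) (h1 : α < 1)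
    (hT : 0 < T) (hr : 1 ≤ r) (hN : 1 ≤ N) (hn2 : 2 ≤ n) (hn : n ≤ N) :
    ‖(∑ k ∈ Finset.Icc 1 n, L1w T r α N n k • (u (gm T r N k) - u (gm T r N (k - 1)))) -
        ∫ s in (0 : ℝ)..gm T r N n, betaK (1 - α) (gm T r N n - s) • u' s‖ ≤
      L1w T r α N n 2 * (2 * (Cu * (gm T r N 1 ^ α / α))) +
        ∑ k ∈ Finset.Ico 1 n, (L1w T r α N n (k + 1) - L1w T r α N n k) *
          (Cu * ((gm T r N (k + 1) - gm T r N k) ^ 2 * gm T r N k ^ (α - 2))) := by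
  have hm := gm_strictMono hT hr hN
  have hCu := h.const_nonneg hT
  have hpos : ∀ k, 1 ≤ k → 0 < gm T r N k := fun k hk => by
    simpa [gm_zero T N hr] using hm hk
  rw [truncation_eq_sum_local h h0 h1 hT hr hN hn, Finset.range_eq_Ico,
    Finset.sum_eq_sum_Ico_succ_bot (by omega)]
  refine (norm_add_le _ _).trans (add_le_add ?_ ((norm_sum_le _ _).trans
    (Finset.sum_le_sum fun k hk => ?_)))
  · have ha := L1w_nonneg h0 h1 hT hr hN le_rfl (by omega : 1 ≤ n)
    have ha2 := L1w_le_succ h0 h1 hT hr hN le_rfl hn2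
    have hq := betaK_le_L1w h0 h1 hT hr hN one_le_two hn2
    rw [show 2 - 1 = 1 from rfl] at hq
    have hB : 0 ≤ Cu * (gm T r N 1 ^ α / α) := by
      have := hpos 1 le_rfl
      positivity
    have hle := gm_le hT hr hN hN
    rw [zero_add, gm_zero T N hr]
    refine (norm_sub_le _ _).trans ?_
    rw [norm_smul, Real.norm_of_nonneg ha]
    have e1 := mul_le_mul ha2 (h.norm_sub_zero_le h0 (hpos 1 le_rfl).le hle) (norm_nonneg _)
      (ha.trans ha2)
    have e2 := (h.norm_integral_betaK_smul_le_of_lt h0 h1 hT (hpos 1 le_rfl).le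
      (hm (by omega : 1 < n)) hle).trans (mul_le_mul_of_nonneg_right hq hB)
    norm_num at e1 e2 ⊢
    linarith
  · rw [zero_add, Finset.mem_Ico] at hk
    have hτ := sub_pos.2 (hm (Nat.lt_succ_self k))
    have hw := L1w_mul h1 hT hr hN n (Nat.le_add_left 1 k)
    rw [Nat.add_sub_cancel] at hw
    have hL := L1w_le_betaK h0 h1 hT hr hN hk.1 hk.2
    have hloc := h.norm_local_error_le h0 h1 hT (hpos k hk.1) (hm (Nat.lt_succ_self k))
      (hm.monotone hk.2) (gm_le hT hr hN hn)
    rw [← hw, mul_div_cancel_right₀ _ hτ.ne'] at hloc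
    refine hloc.trans ?_
    have hgk := hpos k hk.1
    calc _ = (L1w T r α N n (k + 1) - betaK (1 - α) (gm T r N n - gm T r N k)) *
          (Cu * ((gm T r N (k + 1) - gm T r N k) ^ 2 * gm T r N k ^ (α - 2))) := by ring
      _ ≤ _ := by gcongr

end Truncation

/-- The compensation between local truncation coefficients and the first column of weights. -/
lemma L1w_self_mul_le {T r α Cu : ℝ} {N k : ℕ} (h0 : 0 < α) (h1 : α < 1) (hT : 0 < T)
    (hr : 1 ≤ r) (hCu : 0 ≤ Cu) (hk : 1 ≤ k) (hkN : k + 1 ≤ N) :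
    L1w T r α N k k * (Cu * ((gm T r N (k + 1) - gm T r N k) ^ 2 * gm T r N k ^ (α - 2))) ≤
      Cu / (1 - α) * (T ^ α * (r * 2 ^ (r - 1)) ^ 2 * (N : ℝ) ^ (-(min (2 - α) (r * α)))) *
        L1w T r α N k 1 := by
  have hN : 1 ≤ N := by omega
  have h1' : 0 < 1 - α := by linarith
  have hG := Real.Gamma_pos_of_pos h1'
  have hb := betaK_le_L1w h0 h1 hT hr hN le_rfl hk
  rw [Nat.sub_self, gm_zero T N hr, sub_zero, betaK_one_sub] at hb
  refine le_trans ?_ (mul_le_mul_of_nonneg_left hb (by positivity))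
  rw [L1w_self h1 hT hr hN hk, Gamma_two_sub h1]
  have hg := mul_le_mul_of_nonneg_left (gm_graded_bound hT hr h0 hk hkN)
    (by positivity : 0 ≤ Cu / ((1 - α) * Real.Gamma (1 - α)))
  calc _ = _ := by ring
    _ ≤ _ := hg
    _ = _ := by field_simp

theorem stmt_19 (T α₀ r Cu : ℝ) (hT : 0 < T) (h0 : 0 < α₀) (h1 : α₀ < 1) (hr : 1 ≤ r) :
    ∃ C > 0, ∀ (E : Type) [NormedAddCommGroup E] [NormedSpace ℝ E] [CompleteSpace E],
      ∀ N : ℕ, 1 ≤ N →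
      ∀ P : ℕ → ℕ → ℝ,
        (∀ n : ℕ, 1 ≤ n → n ≤ N → P n 0 = 1 / L1w T r α₀ N n n) →
        (∀ n k : ℕ, 1 ≤ k → k + 1 ≤ n → n ≤ N →
          P n (n - k) = (1 / L1w T r α₀ N k k) *
            ∑ j ∈ Finset.Icc (k + 1) n,
              (L1w T r α₀ N j (k + 1) - L1w T r α₀ N j k) * P n (n - j)) →
      ∀ u u' u'' : ℝ → E,
        ContinuousOn u (Set.Icc 0 T) →
        (∀ s ∈ Set.Ioc (0:ℝ) T, HasDerivAt u (u' s) s) →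
        (∀ s ∈ Set.Ioc (0:ℝ) T, HasDerivAt u' (u'' s) s) →
        ContinuousOn u'' (Set.Ioc 0 T) →
        (∀ s ∈ Set.Ioc (0:ℝ) T, ‖u' s‖ ≤ Cu * s ^ (α₀ - 1)) →
        (∀ s ∈ Set.Ioc (0:ℝ) T, ‖u'' s‖ ≤ Cu * s ^ (α₀ - 2)) →
        ∀ m : ℕ, 1 ≤ m → m ≤ N →
          ∑ n ∈ Finset.Icc 1 m, P m (m - n) *
            ‖(∑ k ∈ Finset.Icc 1 n,
                L1w T r α₀ N n k • (u (gm T r N k) - u (gm T r N (k - 1)))) -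
              ∫ s in (0:ℝ)..gm T r N n, betaK (1 - α₀) (gm T r N n - s) • u' s‖ ≤
            C * (N : ℝ) ^ (-(min (2 - α₀) (r * α₀))) := by
  have h1' : 0 < 1 - α₀ := by linarith
  have hG := Real.Gamma_pos_of_pos h1'
  refine ⟨|Cu| * (T ^ α₀ * (1 / α₀ + (1 - α₀) * (2 / α₀ + 2 / (1 - α₀)) + 2 / α₀) +
    T ^ α₀ * (r * 2 ^ (r - 1)) ^ 2 / (1 - α₀)) + 1, by positivity, ?_⟩
  intro E _ _ _ N hN P hP0 hP u u' u'' hu hu' hu'' _ hb1 hb2 m hm1 hmN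
  have h : WeaklySingular α₀ T Cu u u' u'' := ⟨hu, hu', hu'', hb1, hb2⟩
  have hCu := h.const_nonneg hT
  have hN0 : (1 : ℝ) ≤ N := by exact_mod_cast hN
  have ha1 := L1w_self_pos (r := r) (N := N) h1 hT hr hN le_rfl
  have hg1 : 0 < gm T r N 1 := by
    simpa [gm_zero T N hr] using gm_strictMono hT hr hN Nat.one_pos
  have key := complementary_sum_le (a := L1w T r α₀ N) (p := fun n => P m (m - n)) (m := m) hm1
    (fun k hk _ => L1w_self_pos h1 hT hr hN hk)
    (fun j k hk hkj _ => L1w_le_succ h0 h1 hT hr hN hk hkj)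
    (fun j hj _ => L1w_nonneg h0 h1 hT hr hN le_rfl hj)
    (by simpa using hP0 m hm1 hmN)
    (fun k hk hkm => hP m k hk hkm hmN)
    (R := fun n => ‖(∑ k ∈ Finset.Icc 1 n,
        L1w T r α₀ N n k • (u (gm T r N k) - u (gm T r N (k - 1)))) -
      ∫ s in (0:ℝ)..gm T r N n, betaK (1 - α₀) (gm T r N n - s) • u' s‖)
    (by positivity) (by positivity) (by positivity)
    (norm_truncation_one_le h h0 h1 hT hr hN)
    (fun n hn hnm => norm_truncation_le h h0 h1 hT hr hN hn (hnm.trans hmN))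
    (fun k hk hkm => L1w_self_mul_le h0 h1 hT hr hCu hk (hkm.trans hmN))
  refine key.trans ?_
  set M := (N : ℝ) ^ (-(min (2 - α₀) (r * α₀))) with hM
  have hM0 : 0 ≤ M := by positivity
  have hgM : gm T r N 1 ^ α₀ ≤ T ^ α₀ * M := by
    rw [gm_one_rpow hT]
    exact mul_le_mul_of_nonneg_left
      (Real.rpow_le_rpow_of_exponent_le hN0 (neg_le_neg (min_le_right _ _))) (by positivity)
  have hinv : 1 / L1w T r α₀ N 1 1 = (1 - α₀) * Real.Gamma (1 - α₀) * gm T r N 1 ^ α₀ := by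
    rw [L1w_self h1 hT hr hN le_rfl, Nat.sub_self, gm_zero T N hr, sub_zero, Gamma_two_sub h1,
      Real.rpow_neg hg1.le, one_div_div, div_inv_eq_mul]
  have e1 : (L1w T r α₀ N 1 1 * (Cu * (gm T r N 1 ^ α₀ / α₀)) +
      Cu / Real.Gamma (1 - α₀) * (2 / α₀ + 2 / (1 - α₀))) / L1w T r α₀ N 1 1 =
      Cu * (1 / α₀ + (1 - α₀) * (2 / α₀ + 2 / (1 - α₀))) * gm T r N 1 ^ α₀ := by
    rw [add_div, mul_div_cancel_left₀ _ ha1.ne', div_eq_mul_one_div _ (L1w T r α₀ N 1 1), hinv]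
    field_simp
  rw [e1, abs_of_nonneg hCu]
  calc _ = Cu * (1 / α₀ + (1 - α₀) * (2 / α₀ + 2 / (1 - α₀)) + 2 / α₀) * gm T r N 1 ^ α₀ +
        Cu * (T ^ α₀ * (r * 2 ^ (r - 1)) ^ 2 / (1 - α₀)) * M := by ring
    _ ≤ Cu * (1 / α₀ + (1 - α₀) * (2 / α₀ + 2 / (1 - α₀)) + 2 / α₀) * (T ^ α₀ * M) +
        Cu * (T ^ α₀ * (r * 2 ^ (r - 1)) ^ 2 / (1 - α₀)) * M := by gcongr
    _ ≤ _ := by linarith
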